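/- Let m ∈ ℝ with m ≠ 0. Consider phase space ℝ⁴ × ℝ⁴ with coordinates (q₁,q₂,q₃,λ) and conjugate momenta (p₁,p₂,p₃,p_λ), and the canonical Poisson bracket {f, g} = Σᵢ (∂f/∂pᵢ)(∂g/∂qᵢ) − (∂g/∂pᵢ)(∂f/∂qᵢ) + (∂f/∂p_λ)(∂g/∂λ) − (∂g/∂p_λ)(∂f/∂λ). Define the four constraint functions ψ₁ = p_λ, ψ₂ = q₁²+q₂²+q₃² − 1, ψ₃ = p₁q₁+p₂q₂+p₃q₃, ψ₄ = 2mλ + p₁²+p₂²+p₃². Then at every point z of the constraint manifold {ψ₁ = ψ₂ = ψ₃ = ψ₄ = 0}, the 4 × 4 Poisson bracket matrix M(z) with entries M(z)_{αβ} = {ψ_α, ψ_β}(z) has determinant 16m² ≠ 0, i.e. M(z) is invertible; hence all four constraints are of the second class. -/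

import Mathlib

/-- Partial derivative with respect to the `i`-th coordinate (`q₁,q₂,q₃,λ` for
`i = 0,1,2,3`) of a function on phase space `ℝ⁴ × ℝ⁴`. -/
noncomputable def pdQ (f : (Fin 4 → ℝ) × (Fin 4 → ℝ) → ℝ) (i : Fin 4)
    (z : (Fin 4 → ℝ) × (Fin 4 → ℝ)) : ℝ :=
  fderiv ℝ f z (Pi.single i 1, 0)

/-- Partial derivative with respect to the `i`-th momentum (`p₁,p₂,p₃,p_λ` for
`i = 0,1,2,3`). -/
noncomputable def pdP (f : (Fin 4 → ℝ) × (Fin 4 → ℝ) → ℝ) (i : Fin 4)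
    (z : (Fin 4 → ℝ) × (Fin 4 → ℝ)) : ℝ :=
  fderiv ℝ f z (0, Pi.single i 1)

/-- The canonical Poisson bracket
`{f, g} = Σᵢ (∂f/∂pᵢ)(∂g/∂qᵢ) − (∂g/∂pᵢ)(∂f/∂qᵢ)` on `ℝ⁴ × ℝ⁴` (the sum runs
over `q₁,q₂,q₃,λ` and their conjugate momenta). -/
noncomputable def poissonBracket (f g : (Fin 4 → ℝ) × (Fin 4 → ℝ) → ℝ)
    (z : (Fin 4 → ℝ) × (Fin 4 → ℝ)) : ℝ :=
  ∑ i : Fin 4, (pdP f i z * pdQ g i z - pdP g i z * pdQ f i z)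

/-- The four constraints of the rigid rotator of mass `m`:
`ψ₁ = p_λ`, `ψ₂ = q² − 1`, `ψ₃ = p·q`, `ψ₄ = 2mλ + p²`. -/
noncomputable def psi (m : ℝ) : Fin 4 → (Fin 4 → ℝ) × (Fin 4 → ℝ) → ℝ
  | 0 => fun z => z.2 3
  | 1 => fun z => z.1 0 ^ 2 + z.1 1 ^ 2 + z.1 2 ^ 2 - 1
  | 2 => fun z => z.2 0 * z.1 0 + z.2 1 * z.1 1 + z.2 2 * z.1 2
  | 3 => fun z => 2 * m * z.1 3 + z.2 0 ^ 2 + z.2 1 ^ 2 + z.2 2 ^ 2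

/-- The differential of the `i`-th coordinate `q i` on phase space. -/
noncomputable def dQ (i : Fin 4) : (Fin 4 → ℝ) × (Fin 4 → ℝ) →L[ℝ] ℝ :=
  (ContinuousLinearMap.proj i).comp (ContinuousLinearMap.fst ℝ (Fin 4 → ℝ) (Fin 4 → ℝ))

/-- The differential of the `i`-th momentum `p i` on phase space. -/
noncomputable def dP (i : Fin 4) : (Fin 4 → ℝ) × (Fin 4 → ℝ) →L[ℝ] ℝ :=
  (ContinuousLinearMap.proj i).comp (ContinuousLinearMap.snd ℝ (Fin 4 → ℝ) (Fin 4 → ℝ))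

@[simp] lemma dQ_apply (i : Fin 4) (v : (Fin 4 → ℝ) × (Fin 4 → ℝ)) : dQ i v = v.1 i := rfl

@[simp] lemma dP_apply (i : Fin 4) (v : (Fin 4 → ℝ) × (Fin 4 → ℝ)) : dP i v = v.2 i := rfl

lemma hasFDerivAt_coord (i : Fin 4) (z : (Fin 4 → ℝ) × (Fin 4 → ℝ)) :
    HasFDerivAt (fun z : (Fin 4 → ℝ) × (Fin 4 → ℝ) => z.1 i) (dQ i) z :=
  (dQ i).hasFDerivAt

lemma hasFDerivAt_momentum (i : Fin 4) (z : (Fin 4 → ℝ) × (Fin 4 → ℝ)) :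
    HasFDerivAt (fun z : (Fin 4 → ℝ) × (Fin 4 → ℝ) => z.2 i) (dP i) z :=
  (dP i).hasFDerivAt

lemma fderiv_psi_zero_apply (m : ℝ) (z v : (Fin 4 → ℝ) × (Fin 4 → ℝ)) :
    fderiv ℝ (psi m 0) z v = v.2 3 := by
  have h : HasFDerivAt (psi m 0) _ z := hasFDerivAt_momentum 3 z
  rw [h.fderiv, dP_apply]

lemma fderiv_psi_one_apply (m : ℝ) (z v : (Fin 4 → ℝ) × (Fin 4 → ℝ)) :
    fderiv ℝ (psi m 1) z v = 2 * (z.1 0 * v.1 0 + z.1 1 * v.1 1 + z.1 2 * v.1 2) := by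
  have h : HasFDerivAt (psi m 1) _ z :=
    ((((hasFDerivAt_coord 0 z).pow 2).add ((hasFDerivAt_coord 1 z).pow 2)).add
      ((hasFDerivAt_coord 2 z).pow 2)).sub_const 1
  rw [h.fderiv]
  simp
  ring

lemma fderiv_psi_two_apply (m : ℝ) (z v : (Fin 4 → ℝ) × (Fin 4 → ℝ)) :
    fderiv ℝ (psi m 2) z v = z.2 0 * v.1 0 + z.2 1 * v.1 1 + z.2 2 * v.1 2
      + (z.1 0 * v.2 0 + z.1 1 * v.2 1 + z.1 2 * v.2 2) := by
  have h : HasFDerivAt (psi m 2) _ z :=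
    (((hasFDerivAt_momentum 0 z).mul (hasFDerivAt_coord 0 z)).add
      ((hasFDerivAt_momentum 1 z).mul (hasFDerivAt_coord 1 z))).add
      ((hasFDerivAt_momentum 2 z).mul (hasFDerivAt_coord 2 z))
  rw [h.fderiv]
  simp
  ring

lemma fderiv_psi_three_apply (m : ℝ) (z v : (Fin 4 → ℝ) × (Fin 4 → ℝ)) :
    fderiv ℝ (psi m 3) z v =
      2 * m * v.1 3 + 2 * (z.2 0 * v.2 0 + z.2 1 * v.2 1 + z.2 2 * v.2 2) := by
  have h : HasFDerivAt (psi m 3) _ z :=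
    ((((hasFDerivAt_coord 3 z).const_mul (2 * m)).add
      ((hasFDerivAt_momentum 0 z).pow 2)).add ((hasFDerivAt_momentum 1 z).pow 2)).add
      ((hasFDerivAt_momentum 2 z).pow 2)
  rw [h.fderiv]
  simp
  ring

lemma poissonBracket_self (f : (Fin 4 → ℝ) × (Fin 4 → ℝ) → ℝ)
    (z : (Fin 4 → ℝ) × (Fin 4 → ℝ)) : poissonBracket f f z = 0 := by
  simp [poissonBracket]

lemma poissonBracket_antisymm (f g : (Fin 4 → ℝ) × (Fin 4 → ℝ) → ℝ)
    (z : (Fin 4 → ℝ) × (Fin 4 → ℝ)) : poissonBracket f g z = -poissonBracket g f z := by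
  simp [poissonBracket]

/-- The determinant of a skew-symmetric `4 × 4` matrix is the square of its Pfaffian. -/
lemma Matrix.det_fin_four_of_skew {R : Type*} [CommRing R] (A : Matrix (Fin 4) (Fin 4) R)
    (hd : ∀ i, A i i = 0) (hs : ∀ i j, A i j = -A j i) :
    A.det = (A 0 1 * A 2 3 - A 0 2 * A 1 3 + A 0 3 * A 1 2) ^ 2 := by
  rw [Matrix.det_succ_row_zero]
  simp [Fin.sum_univ_succ, Matrix.det_fin_three, Fin.succAbove]
  simp [hd, hs 1 0, hs 2 0, hs 3 0, hs 2 1, hs 3 1, hs 3 2]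
  ring

/-- For `m ≠ 0`, at every point of the constraint manifold of the rigid rotator
the `4 × 4` Poisson bracket matrix of the constraints has determinant `16m² ≠ 0`
and is invertible; hence all four constraints are second class. -/
theorem rigid_rotator_constraints_second_class
    (m : ℝ) (hm : m ≠ 0)
    (z : (Fin 4 → ℝ) × (Fin 4 → ℝ)) (hz : ∀ α : Fin 4, psi m α z = 0)
    (M : Matrix (Fin 4) (Fin 4) ℝ)
    (hM : M = fun α β => poissonBracket (psi m α) (psi m β) z) :
    M.det = 16 * m ^ 2 ∧ M.det ≠ 0 ∧ IsUnit M := by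
  have hq : z.1 0 ^ 2 + z.1 1 ^ 2 + z.1 2 ^ 2 - 1 = 0 := hz 1
  have h01 : M 0 1 = 0 := by
    simp [hM, poissonBracket, pdP, pdQ, Fin.sum_univ_four, fderiv_psi_zero_apply,
      fderiv_psi_one_apply]
  have h02 : M 0 2 = 0 := by
    simp [hM, poissonBracket, pdP, pdQ, Fin.sum_univ_four, fderiv_psi_zero_apply,
      fderiv_psi_two_apply]
  have h03 : M 0 3 = 2 * m := by
    simp [hM, poissonBracket, pdP, pdQ, Fin.sum_univ_four, fderiv_psi_zero_apply,
      fderiv_psi_three_apply]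
  have h12 : M 1 2 = -2 := by
    simp [hM, poissonBracket, pdP, pdQ, Fin.sum_univ_four, fderiv_psi_one_apply,
      fderiv_psi_two_apply]
    linear_combination -2 * hq
  have hdet : M.det = 16 * m ^ 2 := by
    rw [Matrix.det_fin_four_of_skew M (fun i => by rw [hM]; exact poissonBracket_self _ z)
      (fun i j => by rw [hM]; exact poissonBracket_antisymm _ _ z), h01, h02, h03, h12]
    ring
  have hne : M.det ≠ 0 := by
    rw [hdet]
    positivity
  exact ⟨hdet, hne, (Matrix.isUnit_iff_isUnit_det M).2 hne.isUnit⟩
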